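/- Let n ≥ 1 and let a₁, …, aₙ ∈ O_D be nonzero pure quaternions. On V = Fin n → D define the skew-hermitian form h(x, y) = Σᵢ xᵢ·aᵢ·(star yᵢ), let e₁, …, eₙ denote the standard basis of V (so h(eᵢ, eᵢ) = aᵢ and h(eᵢ, eₗ) = 0 for i ≠ l), and let Λ = {v ∈ V : ∀ i, vᵢ ∈ O_D}. Assume there is an integer μ > 4 with ‖N(a_{i+1})‖ ≤ 2^(−μ)·‖N(a_i)‖ for all 1 ≤ i < n, and assume that for every i there is a nonzero cᵢ ∈ ℚ₂ with N(aᵢ) = N(a₁)·cᵢ². Let 1 ≤ m < n, let r ∈ D with ‖N(1 − star r)‖ ≥ 1/4, let λ_{m+1}, …, λₙ ∈ O_D, and set s = (1−r)·e_m − Σ_{u=m+1}^{n} λᵤ·eᵤ (coordinates multiplied on the left) and σ = a_m·(1 − star r); assume σ − star σ = h(s, s), and assume the simple rotation φ : V → V, φ(x) = x − h(x, s)·σ⁻¹·s, maps Λ into Λ. Let 1 ≤ t ≤ n − m be such that λ_{m+t} ≠ 0 and ‖N(λ_{m+t})‖ ≥ ‖N(λ_{m+t+l})‖ for all 1 ≤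 l ≤ n − m − t. Define w = Σ_{u=m+t}^{n} λᵤ·eᵤ, b_i = a_{m+i−1} for i = 1, …, t, b_{t+1} = h(w, w), and Λ' = {c₁·e_m + ⋯ + c_t·e_{m+t−1} + c·w : c₁, …, c_t, c ∈ O_D} ⊆ Λ. Then: (1) φ(Λ') = Λ'; (2) every b_i is nonzero and ‖N(b_{i+1})‖ ≤ 2^(−μ)·‖N(b_i)‖ for all 1 ≤ i ≤ t; and (3) for every i = 1, …, t+1 there is a nonzero c ∈ ℚ₂ with N(b_i) = N(a₁)·c². -/

import Mathlib

open Quaternion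

noncomputable section

/-- `D` is the quaternion algebra `ℍ[ℚ₂, 2, 5]` with `i² = 2`, `j² = 5`, `i·j = -j·i`;
this is the unique quaternion division algebra over `ℚ₂`. -/
abbrev D : Type := ℍ[ℚ_[2], 2, 5]

/-- The basis quaternion `i`. -/
def qi : D := ⟨0, 1, 0, 0⟩

/-- The basis quaternion `j`. -/
def qj : D := ⟨0, 0, 1, 0⟩

/-- `ω = (1 + j)/2`. -/
def qω : D := ⟨1/2, 0, 1/2, 0⟩

/-- The reduced norm `N(q) = q · (star q)` (as a scalar). -/
def qN (q : D) : ℚ_[2] := (q * star q).re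

/-- The reduced trace `T(q) = q + star q = 2·q.re` (as a scalar). -/
def qT (q : D) : ℚ_[2] := 2 * q.re

/-- The skew-hermitian form `h(x, y) = Σᵤ xᵤ · aᵤ · star yᵤ` on `V = Fin n → D`
determined by the diagonal Gram coefficients `a`. -/
def hform {n : ℕ} (a : Fin n → D) (x y : Fin n → D) : D :=
  ∑ u, x u * a u * star (y u)

lemma qN_eq (q : D) : qN q = q.re^2 - 5*q.imJ^2 - 2*(q.imI^2 - 5*q.imK^2) := by
  simp [qN, QuaternionAlgebra.re_mul]; ring
lemma qN_mul (x y : D) : qN (x*y) = qN x * qN y := by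
  rw [qN_eq,qN_eq,qN_eq]; simp; ring
lemma qN_star (x : D) : qN (star x) = qN x := by
  rw [qN_eq,qN_eq]; simp
lemma qN_neg (x : D) : qN (-x) = qN x := by
  rw [qN_eq,qN_eq]; simp
lemma qN_one : qN 1 = 1 := by
  rw [qN_eq]; simp
lemma qN_zero : qN 0 = 0 := by
  rw [qN_eq]; simp
lemma qN_add (x y : D) : qN (x+y) = qN x + 2*(x*star y).re + qN y := by
  rw [qN_eq,qN_eq,qN_eq]; simp; ring

lemma norm_two' : ‖(2:ℚ_[2])‖ = 1/2 := by
  have := Padic.norm_p (p := 2)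
  norm_num at this ⊢; exact this

lemma norm_five : ‖(5:ℚ_[2])‖ = 1 := by
  have := (Padic.norm_natCast_eq_one_iff (p := 2) (n := 5)).2 (by norm_num)
  simpa using this

lemma small_or (v : ℤ_[2]) : ‖v‖ ≤ 1/2 ∨ ‖v+1‖ ≤ 1/2 := by
  have key : ∀ z : ℤ_[2], PadicInt.toZMod z = 0 → ‖z‖ ≤ 1/2 := by
    intro z hz
    have : z ∈ RingHom.ker (PadicInt.toZMod (p := 2)) := hz
    rw [PadicInt.ker_toZMod, PadicInt.maximalIdeal_eq_span_p, ← pow_one ((2:ℕ):ℤ_[2]),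
      ← PadicInt.norm_le_pow_iff_mem_span_pow] at this
    norm_num at this ⊢; exact this
  have h : ∀ z : ZMod 2, z = 0 ∨ z + 1 = 0 := by decide
  rcases h (PadicInt.toZMod v) with h | h
  · exact Or.inl (key _ h)
  · exact Or.inr (key _ (by simpa using h))

lemma small_or' (v : ℚ_[2]) (hv : ‖v‖ ≤ 1) : ‖v‖ ≤ 1/2 ∨ ‖v+1‖ ≤ 1/2 := by
  exact small_or ⟨v, hv⟩

lemma unit_sub (u : ℚ_[2]) (hu : ‖u‖ = 1) : ‖u^2-5‖ = 1/4 := by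
  rcases small_or' u hu.le with h | h
  · linarith
  obtain ⟨v, rfl⟩ : ∃ v, u = 2*v - 1 := ⟨(u+1)/2, by ring⟩
  have hv : ‖v‖ ≤ 1 := by
    have : (2*v-1+1 : ℚ_[2]) = 2*v := by ring
    rw [this, norm_mul, norm_two'] at h; linarith
  have e : (2*v-1)^2-5 = 2*2*(v*(-v+1)*(-1)) + (-(2*2)) := by ring
  have h1 : ‖v*(-v+1)*(-1)‖ ≤ 1/2 := by
    have hv' : ‖-v‖ ≤ 1 := by simpa using hv
    have hv1 : ‖-v+1‖ ≤ 1 := (Padic.nonarchimedean _ _).trans (max_le hv' (by simp))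
    rw [norm_mul, norm_mul]; simp only [norm_neg, norm_one, mul_one]
    rcases small_or' (-v) hv' with h | h
    · rw [norm_neg] at h
      nlinarith [norm_nonneg v, norm_nonneg (-v+1)]
    · nlinarith [norm_nonneg v, norm_nonneg (-v+1)]
  have h2 : ‖(2*2*(v*(-v+1)*(-1)) : ℚ_[2])‖ ≤ 1/8 := by
    rw [norm_mul, norm_mul, norm_two']; linarith
  have h3 : ‖(-(2*2) : ℚ_[2])‖ = 1/4 := by
    rw [norm_neg, norm_mul, norm_two']; norm_num
  rw [e, Padic.add_eq_max_of_ne (by rw [h3]; intro h; linarith), h3]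
  exact max_eq_right (by linarith)

lemma formA (a b : ℚ_[2]) (h : ¬ (a = 0 ∧ b = 0)) :
    ∃ k : ℤ, ‖a^2-5*b^2‖ = ((2:ℝ)^k)^2 ∧ ‖a‖ ≤ 2 * 2^k := by
  have hz : ∀ x : ℚ_[2], x ≠ 0 → ∃ k : ℤ, ‖x‖ = (2:ℝ)^k := by
    intro x hx
    exact ⟨-x.valuation, by simpa using Padic.norm_eq_zpow_neg_valuation hx⟩
  have hb5 : ‖-(5*b^2)‖ = ‖b‖^2 := by rw [norm_neg, norm_mul, norm_five, norm_pow, one_mul]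
  by_cases hab : ‖a‖ = ‖b‖
  · have hb : b ≠ 0 := by
      rintro rfl
      simp at hab; exact h ⟨hab, rfl⟩
    obtain ⟨k, hk⟩ := hz b hb
    have e : a^2-5*b^2 = b^2 * ((a/b)^2-5) := by field_simp
    have hu := unit_sub (a/b) (by rw [norm_div, hab, div_self (norm_ne_zero_iff.2 hb)])
    refine ⟨k-1, ?_, ?_⟩
    · rw [e, norm_mul, hu, norm_pow, hk, zpow_sub₀ (by norm_num)]; ring
    · rw [hab, hk, zpow_sub₀ (by norm_num)]; apply le_of_eq; ring
  · have hne : ‖a^2‖ ≠ ‖-(5*b^2)‖ := by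
      rw [hb5, norm_pow]
      intro h'
      exact hab ((sq_eq_sq₀ (norm_nonneg _) (norm_nonneg _)).1 h')
    have e := Padic.add_eq_max_of_ne hne
    rw [← sub_eq_add_neg, hb5, norm_pow] at e
    rcases lt_or_gt_of_ne hab with hlt | hlt
    · obtain ⟨k, hk⟩ := hz b (by rintro rfl; simp at hlt; exact absurd hlt (not_lt.2 (norm_nonneg _)))
      refine ⟨k, ?_, ?_⟩
      · rw [e, ← hk, max_eq_right]; gcongr
      · rw [← hk]; linarith [norm_nonneg b]
    · obtain ⟨k, hk⟩ := hz a (by rintro rfl; simp at hlt; exact absurd hlt (not_lt.2 (norm_nonneg _)))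
      refine ⟨k, ?_, ?_⟩
      · rw [e, ← hk, max_eq_left]; gcongr
      · rw [← hk]; linarith [norm_nonneg a]

lemma trace_sq (z : D) : ‖2*z.re‖^2 ≤ ‖qN z‖ := by
  rw [qN_eq, norm_mul, norm_two']
  by_cases h : z.re = 0 ∧ z.imJ = 0
  · rw [h.1]; simp
  obtain ⟨k, hk, hk'⟩ := formA _ _ h
  have hA : (1/2*‖z.re‖)^2 ≤ ‖z.re^2 - 5*z.imJ^2‖ := by
    rw [hk]; gcongr; linarith
  refine hA.trans ?_
  by_cases h2 : z.imI = 0 ∧ z.imK = 0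
  · rw [h2.1, h2.2]; simp
  obtain ⟨l, hl, -⟩ := formA _ _ h2
  have hl2 : ‖-(2*(z.imI^2 - 5*z.imK^2))‖ = 1/2 * ((2:ℝ)^l)^2 := by
    rw [norm_neg, norm_mul, norm_two', hl]
  rw [sub_eq_add_neg (z.re^2 - 5*z.imJ^2), Padic.add_eq_max_of_ne]
  · exact le_max_left _ _
  · rw [hk, hl2]
    intro h
    have : (2:ℝ)^(k+k) = (2:ℝ)^(l+l-1) := by
      rw [zpow_sub₀ (by norm_num), zpow_add₀ (by norm_num), zpow_add₀ (by norm_num)]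
      linear_combination h
    have := zpow_right_injective₀ (by norm_num : (0:ℝ)<2) (by norm_num) this
    omega

lemma qN_ne_zero {z : D} (hz : z ≠ 0) : qN z ≠ 0 := by
  intro h
  apply hz
  have key : ∀ y : D, (z*y).re = 0 := by
    intro y
    have := trace_sq (z*y)
    rw [qN_mul, h, zero_mul, norm_zero] at this
    have h3 : ‖2*(z*y).re‖ = 0 := by
      have := le_antisymm this (sq_nonneg _)
      exact pow_eq_zero_iff (two_ne_zero) |>.1 this
    simpa using h3
  have h0 := key 1
  have h1 := key ⟨0,1,0,0⟩
  have h2 := key ⟨0,0,1,0⟩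
  have h3 := key ⟨0,0,0,1⟩
  simp at h0 h1 h2 h3
  ext <;> simp [h0,h1,h2,h3]

lemma qN_add_le {x y : D} {C : ℝ} (hx : ‖qN x‖ ≤ C) (hy : ‖qN y‖ ≤ C) : ‖qN (x+y)‖ ≤ C := by
  have hC : 0 ≤ C := (norm_nonneg _).trans hx
  rw [qN_add]
  refine (Padic.nonarchimedean _ _).trans (max_le ((Padic.nonarchimedean _ _).trans (max_le hx ?_)) hy)
  have := trace_sq (x*star y)
  rw [qN_mul, qN_star, norm_mul (qN _) (qN _)] at this
  refine (sq_le_sq₀ (norm_nonneg _) hC).1 (this.trans ?_)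
  rw [sq]; gcongr

lemma qN_sum_le {ι : Type*} (S : Finset ι) (f : ι → D) {C : ℝ} (hC : 0 ≤ C)
    (h : ∀ i ∈ S, ‖qN (f i)‖ ≤ C) : ‖qN (∑ i ∈ S, f i)‖ ≤ C := by
  classical
  induction S using Finset.induction_on with
  | empty => simpa [qN_zero] using hC
  | insert i S hi ih =>
    rw [Finset.sum_insert hi]
    exact qN_add_le (h i (by simp)) (ih fun j hj => h j (by simp [hj]))

lemma sq_of_near (y : ℚ_[2]) (hy : ‖y‖ ≤ 1/8) : ∃ c : ℚ_[2], c ≠ 0 ∧ 1 + y = c^2 := by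
  have hy1 : ‖y‖ ≤ 1 := by linarith
  let Y : ℤ_[2] := ⟨y, hy1⟩
  let F : Polynomial ℤ_[2] := Polynomial.X^2 - Polynomial.C (1+Y)
  have hF : ∀ z, Polynomial.aeval z F = z^2 - (1+Y) := by intro z; simp [F]
  have hF' : Polynomial.aeval (1:ℤ_[2]) (Polynomial.derivative F) = 2 := by
    simp [F]; norm_num
  have h2 : ‖(2:ℤ_[2])‖ = 1/2 := by
    have := PadicInt.norm_p (p := 2)
    norm_num at this ⊢; exact this
  obtain ⟨z, hz, -⟩ := hensels_lemma (p := 2) (R := ℤ_[2]) (F := F) (a := 1) (by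
    rw [hF, hF', h2]
    have : (1^2 - (1+Y) : ℤ_[2]) = -Y := by ring
    rw [this, norm_neg]
    have : ‖Y‖ = ‖y‖ := rfl
    rw [this]; linarith)
  rw [hF] at hz
  have e : 1 + y = (z:ℚ_[2])^2 := by
    have := congrArg (fun x : ℤ_[2] => (x:ℚ_[2])) hz
    have h3 : (z:ℚ_[2])^2 - (1+y) = 0 := by rw [← PadicInt.coe_zero]; exact this
    linear_combination -h3
  refine ⟨z, ?_, e⟩
  intro h0
  rw [h0] at e
  have : y = -1 := by linear_combination e
  rw [this] at hy; norm_num at hy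

/-- small perturbations do not change the square class of the norm -/
lemma near (p q : D) (hp : p ≠ 0) (h : ‖qN q‖ ≤ 1/32 * ‖qN p‖) :
    ∃ c : ℚ_[2], c ≠ 0 ∧ qN (p+q) = qN p * c^2 := by
  have hp0 := qN_ne_zero hp
  have hpn : 0 < ‖qN p‖ := norm_pos_iff.2 hp0
  obtain ⟨c, hc, e⟩ := sq_of_near ((2*(p*star q).re + qN q)/qN p) (by
    rw [norm_div, div_le_iff₀ hpn]
    refine (Padic.nonarchimedean _ _).trans (max_le ?_ (by linarith))
    have := trace_sq (p*star q)
    rw [qN_mul, qN_star, norm_mul (qN _) (qN _)] at this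
    have h4 : ‖2*(p*star q).re‖ / ‖qN p‖ < (2:ℝ)^(-2:ℤ) := by
      rw [div_lt_iff₀ hpn]
      apply lt_of_pow_lt_pow_left₀ 2 (by positivity)
      refine this.trans_lt ?_
      have : (2:ℝ)^(-2:ℤ) = 1/4 := by norm_num
      rw [this]; nlinarith
    have h5 : ‖2*(p*star q).re/qN p‖ ≤ (2:ℝ)^(-3:ℤ) := by
      rw [← norm_div] at h4
      have := (Padic.norm_le_pow_iff_norm_lt_pow_add_one (p := 2) (2*(p*star q).re/qN p) (-3)).2
      simp only [Nat.cast_ofNat] at this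
      exact this h4
    rw [norm_div, div_le_iff₀ hpn] at h5
    have e8 : (2:ℝ)^(-3:ℤ) = 1/8 := by norm_num
    rwa [e8] at h5)
  refine ⟨c, hc, ?_⟩
  rw [← e, qN_add]; field_simp; ring

lemma hform_sub {n : ℕ} (a x y s : Fin n → D) (κ : D) (h : ∀ u, y u = x u - κ * s u) :
    hform a y s = hform a x s - κ * hform a s s := by
  unfold hform
  rw [Finset.mul_sum, ← Finset.sum_sub_distrib]
  refine Finset.sum_congr rfl fun u _ => ?_
  rw [h]; noncomm_ring


/-- Theorem 2 (reduction theorem).  Indices are 0-based: `a u` for `u = 0, …, n-1` are the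
diagonal coefficients (nonzero pure quaternions of `O_D`), `Λ = O_D^n` is the lattice,
the scales drop by at least `μ > ν(4) = 4` between consecutive components, and all the
`N(aᵤ)` lie in the square class of `N(a₀)`.  Given a simple rotation
`φ = (s; σ) ∈ 𝓑(Λ)` with axis `s = (1-r)·e_m - Σ_{u>m} λᵤ·e_u`, `σ = a_m·(1 - star r)`,
`‖1 - r‖ ≥ ‖2‖` (i.e. `‖N(1 - star r)‖ ≥ 1/4`), and `1 ≤ t` with `λ_{m+t} ≠ 0` of maximal
norm among `λ_{m+t}, …, λ_{n-1}`, the sublattice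
`Λ' = O_D·e_m ⊥ ⋯ ⊥ O_D·e_{m+t-1} ⊥ O_D·w`, where `w = Σ_{u ≥ m+t} λᵤ·e_u`, with
coefficients `b₁ = a_m, …, b_t = a_{m+t-1}, b_{t+1} = h(w, w)`, satisfies:
(1) `φ(Λ') = Λ'`; (2) the `bᵢ` are nonzero and their scales drop by at least `μ`;
(3) every `N(bᵢ)` lies in the square class of `N(a₀)`. -/
theorem stmt_4 (n : ℕ) (hn : 0 < n) (a : Fin n → D)
    (ha0 : ∀ u, a u ≠ 0) (hapure : ∀ u, star (a u) = -a u)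
    (haint : ∀ u, ‖qN (a u)‖ ≤ 1)
    (μ : ℤ) (hμ : 4 < μ)
    (hscale : ∀ u : ℕ, (hu : u + 1 < n) →
      ‖qN (a ⟨u + 1, hu⟩)‖ ≤ (2 : ℝ) ^ (-μ) * ‖qN (a ⟨u, by omega⟩)‖)
    (hsq : ∀ u : Fin n, ∃ c : ℚ_[2], c ≠ 0 ∧ qN (a u) = qN (a ⟨0, hn⟩) * c ^ 2)
    (m : ℕ) (hm : m + 1 < n)
    (r : D) (hr : (1 / 4 : ℝ) ≤ ‖qN (1 - star r)‖)
    (lam : Fin n → D) (hlamint : ∀ u, ‖qN (lam u)‖ ≤ 1)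
    (s : Fin n → D)
    (hs : s = fun u => if u.val = m then 1 - r else if m < u.val then -lam u else 0)
    (σ : D) (hσdef : σ = a ⟨m, by omega⟩ * (1 - star r))
    (hσax : σ - star σ = hform a s s)
    (σInv : D) (hσInv : σ * σInv = 1 ∧ σInv * σ = 1)
    (φ : (Fin n → D) → (Fin n → D))
    (hφ : φ = fun x u => x u - hform a x s * σInv * s u)
    (hφΛ : ∀ v : Fin n → D, (∀ u, ‖qN (v u)‖ ≤ 1) → ∀ u, ‖qN (φ v u)‖ ≤ 1)
    (t : ℕ) (ht1 : 1 ≤ t) (ht2 : m + t < n)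
    (hlamt0 : lam ⟨m + t, ht2⟩ ≠ 0)
    (hlammax : ∀ l : ℕ, (hl : m + t + l < n) →
      ‖qN (lam ⟨m + t + l, hl⟩)‖ ≤ ‖qN (lam ⟨m + t, ht2⟩)‖)
    (w : Fin n → D) (hw : w = fun u => if m + t ≤ u.val then lam u else 0)
    (Λ' : Set (Fin n → D))
    (hΛ' : Λ' = {v : Fin n → D | ∃ (c : Fin n → D) (cw : D),
      (∀ u, ‖qN (c u)‖ ≤ 1) ∧ ‖qN cw‖ ≤ 1 ∧
      v = fun u => if u.val < m then 0 else
        if u.val < m + t then c u else cw * lam u}) :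
    (φ '' Λ' = Λ') ∧
    ((∀ i : ℕ, (hi : i < t) → a ⟨m + i, by omega⟩ ≠ 0) ∧ hform a w w ≠ 0 ∧
      (∀ i : ℕ, (hi : i + 1 < t) →
        ‖qN (a ⟨m + i + 1, by omega⟩)‖ ≤ (2 : ℝ) ^ (-μ) * ‖qN (a ⟨m + i, by omega⟩)‖) ∧
      ‖qN (hform a w w)‖ ≤ (2 : ℝ) ^ (-μ) * ‖qN (a ⟨m + t - 1, by omega⟩)‖) ∧
    ((∀ i : ℕ, (hi : i < t) →
        ∃ c : ℚ_[2], c ≠ 0 ∧ qN (a ⟨m + i, by omega⟩) = qN (a ⟨0, hn⟩) * c ^ 2) ∧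
      (∃ c : ℚ_[2], c ≠ 0 ∧ qN (hform a w w) = qN (a ⟨0, hn⟩) * c ^ 2)) := by
  have h2μ : (2:ℝ)^(-μ) ≤ 1/32 := by
    have : (2:ℝ)^(-μ) ≤ (2:ℝ)^(-5:ℤ) := zpow_le_zpow_right₀ (by norm_num) (by omega)
    refine this.trans (by norm_num)
  have h2μ0 : (0:ℝ) < (2:ℝ)^(-μ) := by positivity
  have hdec : ∀ u k : ℕ, (hk : u + k + 1 < n) →
      ‖qN (a ⟨u + k + 1, hk⟩)‖ ≤ (2:ℝ)^(-μ) * ‖qN (a ⟨u, by omega⟩)‖ := by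
    intro u k
    induction k with
    | zero => intro hk; exact hscale u hk
    | succ k ih =>
      intro hk
      have h1 := hscale (u + k + 1) hk
      have h2 := ih (by omega)
      have h3 := norm_nonneg (qN (a ⟨u + k + 1, by omega⟩))
      have : ‖qN (a ⟨u + (k + 1) + 1, hk⟩)‖ ≤ (2:ℝ)^(-μ) * ‖qN (a ⟨u + k + 1, by omega⟩)‖ := h1
      nlinarith
  have hdec' : ∀ u v : Fin n, u.val < v.val → ‖qN (a v)‖ ≤ (2:ℝ)^(-μ) * ‖qN (a u)‖ := by
    rintro ⟨u, hu⟩ ⟨v, hv⟩ huv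
    obtain ⟨k, rfl⟩ : ∃ k, v = u + k + 1 := ⟨v - u - 1, by simp at huv; omega⟩
    exact hdec u k hv
  have hm' : m < n := by omega
  -- r is integral
  have hσσ : ‖qN (a ⟨m, hm'⟩)‖ * ‖qN (1 - star r)‖ * ‖qN σInv‖ = 1 := by
    rw [← norm_mul, ← norm_mul, ← qN_mul, ← qN_mul, ← hσdef, hσInv.1, qN_one, norm_one]
  have hqs : ‖qN (1 - r)‖ = ‖qN (1 - star r)‖ := by
    rw [← qN_star (1 - r)]; simp
  have hsm : s ⟨m, hm'⟩ = 1 - r := by rw [hs]; simp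
  have hslt : ∀ u : Fin n, u.val < m → s u = 0 := by
    intro u hu; rw [hs]; simp [hu.ne, hu.le]
  have hsgt : ∀ u : Fin n, m < u.val → s u = - lam u := by
    intro u hu; rw [hs]; simp [hu.ne', hu]
  have hkap : ∀ ρ : D, ‖qN ρ‖ = ‖qN σInv‖ → ∀ x : Fin n → D, (∀ u, ‖qN (x u)‖ ≤ 1) →
      ‖qN (hform a x s * ρ)‖ ≤ 1 := by
    intro ρ hρ x hx
    unfold hform
    rw [Finset.sum_mul]
    refine qN_sum_le _ _ zero_le_one fun u _ => ?_
    rw [qN_mul, qN_mul, qN_mul, qN_star, norm_mul, norm_mul, norm_mul, hρ]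
    rcases lt_trichotomy u.val m with h | h | h
    · rw [hslt u h, qN_zero]; simp
    · have : u = ⟨m, hm'⟩ := Fin.ext h
      rw [this, hsm, hqs, mul_assoc, mul_assoc, ← mul_assoc ‖qN (a _)‖, hσσ, mul_one]
      exact hx _
    · rw [hsgt u h, qN_neg]
      have h1 := hdec' ⟨m, hm'⟩ u h
      have hA := norm_nonneg (qN (a ⟨m, hm'⟩))
      have hI := norm_nonneg (qN σInv)
      have h3 : ‖qN (a u)‖ * ‖qN σInv‖ ≤ 1 := by
        calc _ ≤ (1/32 * ‖qN (a ⟨m, hm'⟩)‖) * ‖qN σInv‖ := by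
              gcongr; exact h1.trans (by gcongr)
          _ ≤ ‖qN (a ⟨m, hm'⟩)‖ * ‖qN (1 - star r)‖ * ‖qN σInv‖ := by
              rw [mul_comm (1/32:ℝ)]; gcongr; linarith
          _ = 1 := hσσ
      calc _ = (‖qN (x u)‖ * ‖qN (lam u)‖) * (‖qN (a u)‖ * ‖qN σInv‖) := by ring
        _ ≤ (1 * 1) * 1 := by gcongr; exacts [hx u, hlamint u]
        _ = 1 := by norm_num
  have hrint : ‖qN (1 - r)‖ ≤ 1 := by
    have h1 := hφΛ (fun u => if u.val = m then 1 else 0) (by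
      intro u; split_ifs <;> simp [qN_one, qN_zero]) ⟨m, hm'⟩
    have h2 : hform a (fun u => if u.val = m then 1 else 0) s = σ := by
      unfold hform
      rw [Finset.sum_eq_single ⟨m, hm'⟩]
      · rw [hsm, hσdef]; simp
      · intro b _ hb
        have : b.val ≠ m := fun h => hb (Fin.ext h)
        simp [this]
      · simp
    rw [hφ] at h1
    simp only [h2, hσInv.1, hsm, one_mul, if_true] at h1
    have h3 : ‖qN (-r)‖ ≤ 1 := by
      rw [qN_neg]; simpa using h1
    rw [sub_eq_add_neg]
    exact qN_add_le (by simp [qN_one]) h3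
  have hmap : ∀ ρ : D, ‖qN ρ‖ = ‖qN σInv‖ → ∀ x ∈ Λ',
      (fun u => x u - hform a x s * ρ * s u) ∈ Λ' := by
    intro ρ hρ x hx
    rw [hΛ'] at hx ⊢
    obtain ⟨c, cw, hc, hcw, hxe⟩ := hx
    have hxint : ∀ u, ‖qN (x u)‖ ≤ 1 := by
      intro u; rw [hxe]; dsimp only
      split_ifs
      · simp [qN_zero]
      · exact hc u
      · rw [qN_mul, norm_mul]
        exact mul_le_one₀ hcw (norm_nonneg _) (hlamint u)
    have hκ := hkap ρ hρ x hxint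
    generalize hform a x s * ρ = κ at hκ
    have hsint : ∀ u, ‖qN (-(κ * s u))‖ ≤ 1 := by
      intro u
      rw [qN_neg, qN_mul, norm_mul]
      refine mul_le_one₀ hκ (norm_nonneg _) ?_
      rcases lt_trichotomy u.val m with h | h | h
      · rw [hslt u h, qN_zero]; simp
      · have : u = ⟨m, hm'⟩ := Fin.ext h
        rw [this, hsm]; exact hrint
      · rw [hsgt u h, qN_neg]; exact hlamint u
    refine ⟨fun u => c u - κ * s u, cw + κ, ?_, qN_add_le hcw hκ, ?_⟩
    · intro u; dsimp only; rw [sub_eq_add_neg]; exact qN_add_le (hc u) (hsint u)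
    · funext u
      rw [hxe]; dsimp only
      split_ifs with h1 h2
      · rw [hslt u h1]; simp
      · rfl
      · rw [hsgt u (by omega)]; noncomm_ring
  -- the vector w
  set M : Fin n := ⟨m + t, ht2⟩ with hM
  have hN0 : 0 < ‖qN (a M)‖ := norm_pos_iff.2 (qN_ne_zero (ha0 M))
  have hL0 : 0 < ‖qN (lam M)‖ := norm_pos_iff.2 (qN_ne_zero hlamt0)
  set p : D := lam M * a M * star (lam M) with hp
  have hpN : qN p = qN (a M) * qN (lam M) ^ 2 := by
    rw [hp, qN_mul, qN_mul, qN_star]; ring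
  have hp0 : p ≠ 0 := by
    intro h
    rw [h, qN_zero] at hpN
    exact mul_ne_zero (qN_ne_zero (ha0 M)) (pow_ne_zero 2 (qN_ne_zero hlamt0)) hpN.symm
  have hpn : ‖qN p‖ = ‖qN (a M)‖ * ‖qN (lam M)‖^2 := by rw [hpN, norm_mul, norm_pow]
  have hww : ∃ q : D, hform a w w = p + q ∧ ‖qN q‖ ≤ (1/32) * ‖qN p‖ := by
    refine ⟨∑ u ∈ Finset.univ.erase M, w u * a u * star (w u), ?_, ?_⟩
    · unfold hform
      rw [← Finset.add_sum_erase _ _ (Finset.mem_univ M)]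
      have : w M = lam M := by rw [hw]; simp [hM]
      rw [this]
    · refine qN_sum_le _ _ (by positivity) fun u hu => ?_
      have hu' : u.val ≠ m + t := fun h => (Finset.ne_of_mem_erase hu) (Fin.ext h)
      by_cases h : m + t ≤ u.val
      · have hwu : w u = lam u := by rw [hw]; simp [h]
        rw [hwu, qN_mul, qN_mul, qN_star, norm_mul, norm_mul, hpn]
        have h1 : ‖qN (lam u)‖ ≤ ‖qN (lam M)‖ := by
          have := hlammax (u.val - (m + t)) (by omega)
          have e : (⟨m + t + (u.val - (m + t)), by omega⟩ : Fin n) = u := Fin.ext (by simp; omega)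
          rwa [e] at this
        have h2 : ‖qN (a u)‖ ≤ 1/32 * ‖qN (a M)‖ :=
          (hdec' M u (by simp [hM]; omega)).trans (by gcongr)
        calc _ ≤ ‖qN (lam M)‖ * (1/32 * ‖qN (a M)‖) * ‖qN (lam M)‖ := by gcongr
          _ = _ := by ring
      · have hwu : w u = 0 := by rw [hw]; simp [h]
        rw [hwu]; simp only [zero_mul, qN_zero, norm_zero]; positivity
  obtain ⟨q, hwq, hq⟩ := hww
  obtain ⟨c1, hc1, hc1e⟩ := near p q hp0 hq
  rw [← hwq] at hc1e
  have hw0 : hform a w w ≠ 0 := by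
    intro h
    rw [h, qN_zero] at hc1e
    exact mul_ne_zero (qN_ne_zero hp0) (pow_ne_zero 2 hc1) hc1e.symm
  refine ⟨?_, ⟨fun i hi => ha0 _, hw0, fun i hi => hscale (m + i) (by omega), ?_⟩,
    fun i hi => hsq _, ?_⟩
  · apply Set.Subset.antisymm
    · rintro _ ⟨x, hx, rfl⟩
      rw [hφ]; exact hmap σInv rfl x hx
    · intro x hx
      have hy := hmap (-star σInv) (by rw [qN_neg, qN_star]) x hx
      refine ⟨_, hy, ?_⟩
      rw [hφ]
      funext u
      have hh := hform_sub a x (fun u => x u - hform a x s * -star σInv * s u) s _ (fun u => rfl)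
      dsimp only
      rw [hh, ← hσax]
      generalize hform a x s = H
      have e1 : star σInv * star σ = 1 := by rw [← star_mul, hσInv.1, star_one]
      have e2 : (H - H * -star σInv * (σ - star σ)) * σInv
          = H * star σInv := by
        calc _ = H * σInv + H * star σInv * (σ * σInv) - H * (star σInv * star σ) * σInv := by
              noncomm_ring
          _ = _ := by rw [hσInv.1, e1]; noncomm_ring
      rw [e2]; noncomm_ring
  · have h1 : ‖qN (hform a w w)‖ ≤ ‖qN p‖ := by
      rw [hwq]
      exact qN_add_le le_rfl (by linarith [norm_nonneg (qN p)])
    have h2 := hdec' ⟨m + t - 1, by omega⟩ M (by simp [hM]; omega)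
    refine h1.trans (le_trans ?_ h2)
    rw [hpn]
    exact mul_le_of_le_one_right hN0.le (pow_le_one₀ hL0.le (hlamint M))
  · obtain ⟨c0, hc0, e0⟩ := hsq M
    refine ⟨c0 * qN (lam M) * c1, mul_ne_zero (mul_ne_zero hc0 (qN_ne_zero hlamt0)) hc1, ?_⟩
    rw [hc1e, hpN, e0]; ring
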